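/- arXiv:1911.02758 — 2 statements merged into one kernel-verified Lean document; each statement's English description precedes it below -/
import Mathlib

section
/- Let Q be a quasiorder in which x ≤_Q y holds only when x = y (an antichain), X a second-countable T₀ topological space with Borel base 𝓛(X), and u a term. Then the level 𝓛(X,u) is downward closed under Wadge reducibility: if A, B : X → Q, A ≤_W B, and B ∈ 𝓛(X,u), then A ∈ 𝓛(X,u). -/
open Set

namespace IFHpaper

noncomputable section

/-- The first uncountable ordinal. -/
def w1 : Ordinal.{0} := (Cardinal.aleph 1).ord

/-- A tree: a nonempty, prefix-closed set of finite sequences of naturals. -/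
def IsTree (T : Set (List ℕ)) : Prop :=
  T.Nonempty ∧ ∀ σ τ : List ℕ, σ <+: τ → τ ∈ T → σ ∈ T

/-- A well-founded tree: a tree with no infinite path. -/
def IsWFTree (T : Set (List ℕ)) : Prop :=
  IsTree T ∧ ∀ x : ℕ → ℕ, ∃ n : ℕ, (List.range n).map x ∉ T

/-- The proper extensions of `τ` lying in `T`. -/
def properExt (T : Set (List ℕ)) (τ : List ℕ) : Set (List ℕ) :=
  {τ' | τ' ∈ T ∧ τ <+: τ' ∧ τ ≠ τ'}

/-- The component of a `T`-family at node `τ`:  `U τ` minus the union of the sets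
attached to proper extensions of `τ` in `T`. -/
def component {X : Type} (T : Set (List ℕ)) (U : List ℕ → Set X) (τ : List ℕ) : Set X :=
  U τ \ ⋃ τ' ∈ properExt T τ, U τ'

/-- A `T`-family is monotone if `U τ ⊇ U τ'` whenever `τ ⊑ τ'` in `T`. -/
def MonotoneFam {X : Type} (T : Set (List ℕ)) (U : List ℕ → Set X) : Prop :=
  ∀ τ ∈ T, ∀ τ' ∈ T, τ <+: τ' → U τ' ⊆ U τ

/-- A reduced `T`-family: monotone, with disjoint sets at distinct one-step extensions. -/
def ReducedFam {X : Type} (T : Set (List ℕ)) (U : List ℕ → Set X) : Prop :=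
  MonotoneFam T U ∧
    ∀ (τ : List ℕ) (i j : ℕ), τ ++ [i] ∈ T → τ ++ [j] ∈ T → i ≠ j →
      U (τ ++ [i]) ∩ U (τ ++ [j]) = ∅

/-- An infinite-branching tree: every non-leaf node has all its one-step extensions in `T`. -/
def InfBranching (T : Set (List ℕ)) : Prop :=
  ∀ τ ∈ T, (∃ τ' ∈ T, τ <+: τ' ∧ τ ≠ τ') → ∀ i : ℕ, τ ++ [i] ∈ T

/-- The σ-reduction property for a collection of sets. -/
def SigmaReduction {X : Type} (𝒜 : Set (Set X)) : Prop :=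
  ∀ C : ℕ → Set X, (∀ i, C i ∈ 𝒜) →
    ∃ C' : ℕ → Set X, (∀ i, C' i ∈ 𝒜) ∧ (∀ i, C' i ⊆ C i) ∧
      (∀ i j, i ≠ j → C' i ∩ C' j = ∅) ∧ (⋃ i, C' i) = ⋃ i, C i

/-- A (hierarchy) base in a set `X`: an `ω₁`-indexed family of collections of subsets of `X`,
each closed under countable unions and finite intersections, and increasing in the
appropriate sense. -/
structure IsBase {X : Type} (L : Ordinal.{0} → Set (Set X)) : Prop where
  iUnion_mem : ∀ α < w1, ∀ f : ℕ → Set X, (∀ n, f n ∈ L α) → (⋃ n, f n) ∈ L α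
  inter_mem : ∀ α < w1, ∀ A B : Set X, A ∈ L α → B ∈ L α → A ∩ B ∈ L α
  empty_mem : ∀ α < w1, (∅ : Set X) ∈ L α
  univ_mem : ∀ α < w1, (univ : Set X) ∈ L α
  mono : ∀ α β : Ordinal.{0}, α < β → β < w1 → ∀ A : Set X, A ∈ L α → A ∈ L β ∧ Aᶜ ∈ L β

/-- The `β`-shift of a base: level `α` of the shift is level `β + α` of `L`. -/
def shiftL {X : Type} (L : Ordinal.{0} → Set (Set X)) (β : Ordinal.{0}) :
    Ordinal.{0} → Set (Set X) := fun α => L (β + α)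

/-- The `V`-restriction of a base: level `α` consists of the sets `V ∩ S`, `S ∈ L α`. -/
def restrictL {X : Type} (L : Ordinal.{0} → Set (Set X)) (V : Set X) :
    Ordinal.{0} → Set (Set X) := fun α => {W | ∃ S ∈ L α, W = V ∩ S}

open Classical in
/-- The Borel hierarchy `Σ⁰_α(X)` (defined for `1 ≤ α`): `Σ⁰₁` is the open sets, `Σ⁰₂` the
countable unions of differences of open sets, and for `α > 2`, `Σ⁰_α` consists of the
countable unions of complements of sets in lower levels `Σ⁰_β`, `1 ≤ β < α`. -/
def SigmaO (X : Type) [TopologicalSpace X] (α : Ordinal.{0}) : Set (Set X) :=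
  if α = 1 then {U : Set X | IsOpen U}
  else if α = 2 then
    {A : Set X | ∃ U V : ℕ → Set X, (∀ n, IsOpen (U n)) ∧ (∀ n, IsOpen (V n)) ∧
      A = ⋃ n, U n \ V n}
  else
    {A : Set X | ∃ S : ℕ → Set X,
      (∀ n, ∃ β : Ordinal.{0}, ∃ _ : β < α, 1 ≤ β ∧ S n ∈ SigmaO X β) ∧ A = ⋃ n, (S n)ᶜ}
termination_by α
decreasing_by assumption

/-- The Borel base of a topological space: level `α` is `Σ⁰_{1+α}(X)`. -/
def borelBase (X : Type) [TopologicalSpace X] : Ordinal.{0} → Set (Set X) :=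
  fun α => SigmaO X (1 + α)

/-- The existential category quantifier `f[A]`:  the set of `y` such that `A ∩ f⁻¹(y)` is
non-meager in the subspace `f⁻¹(y)`. -/
def catIm {X Y : Type} [TopologicalSpace X] (f : X → Y) (A : Set X) : Set Y :=
  {y | ¬ IsMeagre ((Subtype.val : (f ⁻¹' {y} : Set X) → X) ⁻¹' A)}

/-- A space is zero-dimensional if it has a basis of clopen sets. -/
def ZeroDim (X : Type) [TopologicalSpace X] : Prop :=
  ∀ (x : X) (U : Set X), IsOpen U → x ∈ U → ∃ V : Set X, IsClopen V ∧ x ∈ V ∧ V ⊆ U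

/-- Countable ordinals. -/
abbrev CtbOrd : Type 1 := {α : Ordinal.{0} // α < w1}

/-- Terms over a quasiorder `Q`: constants `q ∈ Q`, unary `s_α`, and `ω`-ary `F_q`, `F_α`
(`α` a countable ordinal). -/
inductive Term (Q : Type) : Type 1 where
  | const : Q → Term Q
  | s : CtbOrd → Term Q → Term Q
  | Fc : Q → (ℕ → Term Q) → Term Q
  | Fo : CtbOrd → (ℕ → Term Q) → Term Q

/-- The relation `⊴` on terms. -/
inductive TLE {Q : Type} [Preorder Q] : Term Q → Term Q → Prop where
  | const_const {q r : Q} : q ≤ r → TLE (.const q) (.const r)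
  | const_s {q : Q} {a : CtbOrd} {u : Term Q} :
      TLE (.const q) u → TLE (.const q) (.s a u)
  | const_Fc_left {q r : Q} {vs : ℕ → Term Q} :
      TLE (.const q) (.const r) → TLE (.const q) (.Fc r vs)
  | const_Fc_right {q r : Q} {vs : ℕ → Term Q} (i : ℕ) :
      TLE (.const q) (vs i) → TLE (.const q) (.Fc r vs)
  | const_Fo {q : Q} {b : CtbOrd} {vs : ℕ → Term Q} (i : ℕ) :
      TLE (.const q) (vs i) → TLE (.const q) (.Fo b vs)
  | s_const {a : CtbOrd} {u : Term Q} {r : Q} :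
      TLE u (.const r) → TLE (.s a u) (.const r)
  | s_s_lt {a b : CtbOrd} {u v : Term Q} :
      a.1 < b.1 → TLE u (.s b v) → TLE (.s a u) (.s b v)
  | s_s_eq {a : CtbOrd} {u v : Term Q} :
      TLE u v → TLE (.s a u) (.s a v)
  | s_s_gt {a b : CtbOrd} {u v : Term Q} :
      b.1 < a.1 → TLE (.s a u) v → TLE (.s a u) (.s b v)
  | s_Fc_left {a : CtbOrd} {u : Term Q} {r : Q} {vs : ℕ → Term Q} :
      TLE (.s a u) (.const r) → TLE (.s a u) (.Fc r vs)
  | s_Fc_right {a : CtbOrd} {u : Term Q} {r : Q} {vs : ℕ → Term Q} (i : ℕ) :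
      TLE (.s a u) (vs i) → TLE (.s a u) (.Fc r vs)
  | s_Fo_left {a : CtbOrd} {u : Term Q} {b : CtbOrd} {vs : ℕ → Term Q} :
      TLE (.s a u) (.s b (vs 0)) → TLE (.s a u) (.Fo b vs)
  | s_Fo_right {a : CtbOrd} {u : Term Q} {b : CtbOrd} {vs : ℕ → Term Q} (i : ℕ) :
      TLE (.s a u) (vs (i + 1)) → TLE (.s a u) (.Fo b vs)
  | Fc_const {q : Q} {us : ℕ → Term Q} {r : Q} :
      TLE (.const q) (.const r) → (∀ i, TLE (us i) (.const r)) →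
      TLE (.Fc q us) (.const r)
  | Fc_s {q : Q} {us : ℕ → Term Q} {b : CtbOrd} {v : Term Q} :
      TLE (.const q) (.s b v) → (∀ i, TLE (us i) (.s b v)) →
      TLE (.Fc q us) (.s b v)
  | Fc_Fc_left {q : Q} {us : ℕ → Term Q} {r : Q} {vs : ℕ → Term Q} :
      TLE (.const q) (.const r) → (∀ i, TLE (us i) (.Fc r vs)) →
      TLE (.Fc q us) (.Fc r vs)
  | Fc_Fc_right {q : Q} {us : ℕ → Term Q} {r : Q} {vs : ℕ → Term Q} (i : ℕ) :
      TLE (.Fc q us) (vs i) → TLE (.Fc q us) (.Fc r vs)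
  | Fc_Fo_left {q : Q} {us : ℕ → Term Q} {b : CtbOrd} {vs : ℕ → Term Q} :
      TLE (.const q) (.s b (vs 0)) → (∀ i, TLE (us i) (.Fo b vs)) →
      TLE (.Fc q us) (.Fo b vs)
  | Fc_Fo_right {q : Q} {us : ℕ → Term Q} {b : CtbOrd} {vs : ℕ → Term Q} (i : ℕ) :
      TLE (.Fc q us) (vs (i + 1)) → TLE (.Fc q us) (.Fo b vs)
  | Fo_const {a : CtbOrd} {us : ℕ → Term Q} {r : Q} :
      TLE (.s a (us 0)) (.const r) → (∀ i, TLE (us (i + 1)) (.const r)) →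
      TLE (.Fo a us) (.const r)
  | Fo_s {a : CtbOrd} {us : ℕ → Term Q} {b : CtbOrd} {v : Term Q} :
      TLE (.s a (us 0)) (.s b v) → (∀ i, TLE (us (i + 1)) (.s b v)) →
      TLE (.Fo a us) (.s b v)
  | Fo_Fc_left {a : CtbOrd} {us : ℕ → Term Q} {r : Q} {vs : ℕ → Term Q} :
      TLE (.s a (us 0)) (.const r) → (∀ i, TLE (us (i + 1)) (.Fc r vs)) →
      TLE (.Fo a us) (.Fc r vs)
  | Fo_Fc_right {a : CtbOrd} {us : ℕ → Term Q} {r : Q} {vs : ℕ → Term Q} (i : ℕ) :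
      TLE (.Fo a us) (vs i) → TLE (.Fo a us) (.Fc r vs)
  | Fo_Fo_left {a : CtbOrd} {us : ℕ → Term Q} {b : CtbOrd} {vs : ℕ → Term Q} :
      TLE (.s a (us 0)) (.s b (vs 0)) → (∀ i, TLE (us (i + 1)) (.Fo b vs)) →
      TLE (.Fo a us) (.Fo b vs)
  | Fo_Fo_right {a : CtbOrd} {us : ℕ → Term Q} {b : CtbOrd} {vs : ℕ → Term Q} (i : ℕ) :
      TLE (.Fo a us) (vs (i + 1)) → TLE (.Fo a us) (.Fo b vs)

/-- `u`-families over a base `L`, on a domain (ambient set) `D ⊆ X`, defined by recursion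
on the term `u` following the labeled tree `T(u)`:
* a `q`-family is trivial;
* an `s_α(u)`-family is a `u`-family over the `ω^α`-shift of the base;
* an `F_q(u₀,…)`-family consists of a monotone `T(u)`-family of level-`0` sets of the base
  restricted to the current domain (encoded via the child sets `U i ∈ 𝓛₀(D)` together with,
  recursively, the `uᵢ`-families on the `U i`, which carry the deeper tree sets);
* an `F_α(u₀,…)`-family additionally carries the `s_α(u₀)`-family attached to the root,
  living on the component `D \ ⋃ᵢ U i` of the root. -/
inductive Fam {X Q : Type} : Term Q → (Ordinal.{0} → Set (Set X)) → Set X → Type 1 where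
  | const (q : Q) (L : Ordinal.{0} → Set (Set X)) (D : Set X) : Fam (.const q) L D
  | s (a : CtbOrd) (u : Term Q) (L : Ordinal.{0} → Set (Set X)) (D : Set X) :
      Fam u (shiftL L (Ordinal.omega0 ^ a.1)) D → Fam (.s a u) L D
  | Fc (q : Q) (us : ℕ → Term Q) (L : Ordinal.{0} → Set (Set X)) (D : Set X)
      (U : ℕ → Set X) (hU : ∀ i, U i ∈ restrictL L D 0)
      (fams : ∀ i, Fam (us i) L (U i)) : Fam (.Fc q us) L D
  | Fo (a : CtbOrd) (us : ℕ → Term Q) (L : Ordinal.{0} → Set (Set X)) (D : Set X)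
      (U : ℕ → Set X) (hU : ∀ i, U i ∈ restrictL L D 0)
      (F0 : Fam (us 0) (shiftL L (Ordinal.omega0 ^ a.1)) (D \ ⋃ i, U i))
      (fams : ∀ i, Fam (us (i + 1)) L (U i)) : Fam (.Fo a us) L D

/-- The relation "the `u`-family `F` (on domain `D`) determines the `Q`-partition `A`". -/
def Determines {X Q : Type} : (u : Term Q) → (L : Ordinal.{0} → Set (Set X)) → (D : Set X) →
    Fam u L D → (X → Q) → Prop
  | _, _, _, .const q _ D, A => ∀ x ∈ D, A x = q
  | _, _, _, .s a u L D F, A => Determines u (shiftL L (Ordinal.omega0 ^ a.1)) D F A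
  | _, _, _, .Fc q us L D U _ fams, A =>
      (∀ x ∈ D \ ⋃ i, U i, A x = q) ∧ ∀ i, Determines (us i) L (U i) (fams i) A
  | _, _, _, .Fo a us L D U _ F0 fams, A =>
      Determines (us 0) (shiftL L (Ordinal.omega0 ^ a.1)) (D \ ⋃ i, U i) F0 A ∧
        ∀ i, Determines (us (i + 1)) L (U i) (fams i) A

/-- A `u`-family is reduced if all monotone tree families occurring in it are reduced
(sets at distinct siblings are disjoint), recursively. -/
def FamReduced {X Q : Type} : (u : Term Q) → (L : Ordinal.{0} → Set (Set X)) → (D : Set X) →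
    Fam u L D → Prop
  | _, _, _, .const _ _ _ => True
  | _, _, _, .s a u L D F => FamReduced u (shiftL L (Ordinal.omega0 ^ a.1)) D F
  | _, _, _, .Fc _ us L _ U _ fams =>
      (∀ i j, i ≠ j → U i ∩ U j = ∅) ∧ ∀ i, FamReduced (us i) L (U i) (fams i)
  | _, _, _, .Fo a us L D U _ F0 fams =>
      (∀ i j, i ≠ j → U i ∩ U j = ∅) ∧
        FamReduced (us 0) (shiftL L (Ordinal.omega0 ^ a.1)) (D \ ⋃ i, U i) F0 ∧
        ∀ i, FamReduced (us (i + 1)) L (U i) (fams i)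

/-- The level `𝓛(D,u)` of the infinitary fine hierarchy over the base `L` restricted to the
domain `D`: the `Q`-partitions determined by some `u`-family on `D`. -/
def levelOn {X : Type} (Q : Type) (L : Ordinal.{0} → Set (Set X)) (D : Set X) (u : Term Q) :
    Set (X → Q) :=
  {A | ∃ F : Fam u L D, Determines u L D F A}

/-- The level `𝓛(X,u)` of the infinitary fine hierarchy over the base `L`. -/
def level {X : Type} (Q : Type) (L : Ordinal.{0} → Set (Set X)) (u : Term Q) : Set (X → Q) :=
  levelOn Q L Set.univ u

/-- `red-𝓛(X,u)`: the `Q`-partitions determined by some reduced `u`-family. -/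
def levelRed {X : Type} (Q : Type) (L : Ordinal.{0} → Set (Set X)) (u : Term Q) :
    Set (X → Q) :=
  {A | ∃ F : Fam u L Set.univ, FamReduced u L Set.univ F ∧ Determines u L Set.univ F A}

/-- Wadge reducibility of `Q`-partitions of a space `X`. -/
def WadgeLe {X : Type} [TopologicalSpace X] {Q : Type} [Preorder Q] (A B : X → Q) : Prop :=
  ∃ f : X → X, Continuous f ∧ ∀ x, A x ≤ B (f x)

/-- The downward Wadge closure `𝓛̂(X,u)` of the level `𝓛(X,u)`. -/
def levelHat {X : Type} [TopologicalSpace X] (Q : Type) [Preorder Q]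
    (L : Ordinal.{0} → Set (Set X)) (u : Term Q) : Set (X → Q) :=
  {A | ∃ B ∈ level Q L u, WadgeLe A B}


theorem preimage_mem_SigmaO {X Y : Type} [TopologicalSpace X] [TopologicalSpace Y] {f : X → Y}
    (hf : Continuous f) (α : Ordinal.{0}) {S : Set Y} (hS : S ∈ SigmaO Y α) :
    f ⁻¹' S ∈ SigmaO X α := by
  induction α using WellFoundedLT.induction generalizing S with
  | ind α ih =>
    rw [SigmaO] at hS ⊢
    split_ifs at hS ⊢ with h1 h2
    · exact IsOpen.preimage hf hS
    · obtain ⟨U, V, hU, hV, rfl⟩ := hS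
      exact ⟨fun n => f ⁻¹' U n, fun n => f ⁻¹' V n, fun n => (hU n).preimage hf,
        fun n => (hV n).preimage hf, by simp only [preimage_iUnion, preimage_sdiff]⟩
    · obtain ⟨C, hC, rfl⟩ := hS
      refine ⟨fun n => f ⁻¹' C n, fun n => ?_, by simp only [preimage_iUnion, preimage_compl]⟩
      obtain ⟨β, hβ, h, hmem⟩ := hC n
      exact ⟨β, hβ, h, ih β hβ hmem⟩

theorem preimage_mem_restrictL {X Y : Type} {f : X → Y} {L : Ordinal.{0} → Set (Set Y)}
    {L' : Ordinal.{0} → Set (Set X)} (hL : ∀ α, ∀ S ∈ L α, f ⁻¹' S ∈ L' α) {D W : Set Y}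
    {α : Ordinal.{0}} (hW : W ∈ restrictL L D α) : f ⁻¹' W ∈ restrictL L' (f ⁻¹' D) α := by
  obtain ⟨S, hS, rfl⟩ := hW
  exact ⟨f ⁻¹' S, hL α S hS, preimage_inter⟩

/-- Families pull back along a map under which preimages respect the bases. The domain `E` of the
pulled-back family need only be propositionally equal to the preimage of the original domain. -/
theorem Fam.exists_pullback {X Y Q : Type} {f : X → Y} {u : Term Q}
    {L : Ordinal.{0} → Set (Set Y)} {D : Set Y} (F : Fam u L D) {L' : Ordinal.{0} → Set (Set X)}
    (hL : ∀ α, ∀ S ∈ L α, f ⁻¹' S ∈ L' α) {E : Set X} (hE : f ⁻¹' D = E) {B : Y → Q}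
    (hB : Determines u L D F B) : ∃ F' : Fam u L' E, Determines u L' E F' (B ∘ f) := by
  subst hE
  induction F generalizing L' with
  | const q L D => exact ⟨.const q L' _, fun x hx => hB (f x) hx⟩
  | s a u L D F ih =>
    obtain ⟨F', hF'⟩ := ih (L' := shiftL L' _) (fun α S hS => hL _ S hS) hB
    exact ⟨.s a u L' _ F', hF'⟩
  | Fc q us L D U hU fams ih =>
    choose G hG using fun i => ih i hL (hB.2 i)
    refine ⟨.Fc q us L' _ (fun i => f ⁻¹' U i) (fun i => preimage_mem_restrictL hL (hU i)) G,
      fun x hx => hB.1 (f x) ?_, hG⟩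
    rwa [← preimage_iUnion, ← preimage_sdiff] at hx
  | Fo a us L D U hU F0 fams ih0 ih =>
    choose G hG using fun i => ih i hL (hB.2 i)
    have h0 := ih0 (L' := shiftL L' (Ordinal.omega0 ^ a.1)) (fun α S hS => hL _ S hS) hB.1
    rw [preimage_sdiff, preimage_iUnion] at h0
    obtain ⟨G0, hG0⟩ := h0
    exact ⟨.Fo a us L' _ (fun i => f ⁻¹' U i) (fun i => preimage_mem_restrictL hL (hU i)) G0 G,
      hG0, hG⟩

/-- Corollary "wadgeclos": for an antichain `Q`, each level of the `Q`-IFH in a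
second-countable `T₀` space is downward closed under Wadge reducibility. -/
theorem statement15 {X Q : Type} [Preorder Q] (hQ : ∀ x y : Q, x ≤ y → x = y)
    [TopologicalSpace X] [SecondCountableTopology X] [T0Space X]
    (u : Term Q) (A B : X → Q) (hAB : WadgeLe A B)
    (hB : B ∈ level Q (borelBase X) u) :
    A ∈ level Q (borelBase X) u := by
  obtain ⟨f, hf, hle⟩ := hAB
  obtain ⟨F, hF⟩ := hB
  obtain rfl : A = B ∘ f := funext fun x => hQ _ _ (hle x)
  exact F.exists_pullback (fun α _ hS => preimage_mem_SigmaO hf (1 + α) hS) preimage_univ hF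

end

end IFHpaper
end

section
/- Let Q be a quasiorder and u a term. Then the level 𝓛(𝒩,u) of the infinitary fine hierarchy over the Borel base of the Baire space 𝒩 = ω^ω contains a Wadge-complete element: there exists B ∈ 𝓛(𝒩,u) such that A ≤_W B for every A ∈ 𝓛(𝒩,u). -/
open Set

namespace IFHpaper

noncomputable section

/-! ### The finite Borel calculus of the classes `SigmaO` -/

section SigmaO

variable {X Y : Type} [TopologicalSpace X] [TopologicalSpace Y]

theorem mem_sigmaO_one {A : Set X} : A ∈ SigmaO X 1 ↔ IsOpen A := by
  rw [SigmaO]; simp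

theorem mem_sigmaO_two {A : Set X} : A ∈ SigmaO X 2 ↔
    ∃ U V : ℕ → Set X, (∀ n, IsOpen (U n)) ∧ (∀ n, IsOpen (V n)) ∧ A = ⋃ n, U n \ V n := by
  rw [SigmaO]; simp

theorem mem_sigmaO_of_two_lt {α : Ordinal.{0}} (h : 2 < α) {A : Set X} : A ∈ SigmaO X α ↔
    ∃ S : ℕ → Set X, (∀ n, ∃ β < α, 1 ≤ β ∧ S n ∈ SigmaO X β) ∧ A = ⋃ n, (S n)ᶜ := by
  have h1 : α ≠ 1 := (one_lt_two.trans h).ne'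
  rw [SigmaO]; simp [h1, h.ne', and_left_comm]

theorem eq_one_or_eq_two_or_two_lt {α : Ordinal.{0}} (h : 1 ≤ α) : α = 1 ∨ α = 2 ∨ 2 < α := by
  rcases h.eq_or_lt with h | h
  · exact .inl h.symm
  · have h2 : (2 : Ordinal.{0}) ≤ α := by
      rw [← one_add_one_eq_two]; exact Order.add_one_le_of_lt h
    exact .inr (h2.eq_or_lt.imp Eq.symm id)

theorem diff_mem_sigmaO_two {U V : Set X} (hU : IsOpen U) (hV : IsOpen V) :
    U \ V ∈ SigmaO X 2 :=
  mem_sigmaO_two.2 ⟨fun _ => U, fun _ => V, fun _ => hU, fun _ => hV, (iUnion_const _).symm⟩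

theorem compl_mem_sigmaO {α β : Ordinal.{0}} (h1 : 1 ≤ β) (h : β < α) {A : Set X}
    (hA : A ∈ SigmaO X β) : Aᶜ ∈ SigmaO X α := by
  rcases eq_one_or_eq_two_or_two_lt (h1.trans h.le) with rfl | rfl | h2
  · exact absurd h h1.not_gt
  · rcases eq_one_or_eq_two_or_two_lt h1 with rfl | rfl | h2
    · rw [compl_eq_univ_sdiff]
      exact diff_mem_sigmaO_two isOpen_univ (mem_sigmaO_one.1 hA)
    · exact absurd h (lt_irrefl _)
    · exact absurd h h2.not_gt
  · exact (mem_sigmaO_of_two_lt h2).2 ⟨fun _ => A, fun _ => ⟨β, h, h1, hA⟩, (iUnion_const _).symm⟩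

theorem univ_mem_sigmaO {α : Ordinal.{0}} (h : 1 ≤ α) : (univ : Set X) ∈ SigmaO X α := by
  rcases h.eq_or_lt with rfl | h
  · exact mem_sigmaO_one.2 isOpen_univ
  · rw [← compl_empty]
    exact compl_mem_sigmaO le_rfl h (mem_sigmaO_one.2 isOpen_empty)

theorem iUnion_mem_sigmaO {α : Ordinal.{0}} (h : 1 ≤ α) {A : ℕ → Set X}
    (hA : ∀ n, A n ∈ SigmaO X α) : (⋃ n, A n) ∈ SigmaO X α := by
  rcases eq_one_or_eq_two_or_two_lt h with rfl | rfl | h2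
  · exact mem_sigmaO_one.2 (isOpen_iUnion fun n => mem_sigmaO_one.1 (hA n))
  · choose U V hU hV h using fun n => mem_sigmaO_two.1 (hA n)
    refine mem_sigmaO_two.2 ⟨fun k => U k.unpair.1 k.unpair.2, fun k => V k.unpair.1 k.unpair.2,
      fun k => hU _ _, fun k => hV _ _, ?_⟩
    rw [iUnion_unpair (fun i j => U i j \ V i j)]
    exact iUnion_congr h
  · choose S hS h using fun n => (mem_sigmaO_of_two_lt h2).1 (hA n)
    refine (mem_sigmaO_of_two_lt h2).2 ⟨fun k => S k.unpair.1 k.unpair.2, fun k => hS _ _, ?_⟩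
    rw [iUnion_unpair (fun i j => (S i j)ᶜ)]
    exact iUnion_congr h

theorem sigmaO_mono {α β : Ordinal.{0}} (h1 : 1 ≤ β) (h : β ≤ α) {A : Set X}
    (hA : A ∈ SigmaO X β) : A ∈ SigmaO X α := by
  rcases h.eq_or_lt with rfl | h
  · exact hA
  rcases eq_one_or_eq_two_or_two_lt h1 with rfl | rfl | h2
  · have h2 : Aᶜ ∈ SigmaO X 2 := compl_mem_sigmaO le_rfl one_lt_two hA
    rcases eq_one_or_eq_two_or_two_lt h.le with rfl | rfl | h3
    · exact hA
    · simpa using diff_mem_sigmaO_two (mem_sigmaO_one.1 hA) isOpen_empty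
    · simpa using compl_mem_sigmaO one_le_two h3 h2
  · obtain ⟨U, V, hU, hV, rfl⟩ := mem_sigmaO_two.1 hA
    refine iUnion_mem_sigmaO (h1.trans h.le) fun n => ?_
    have hd : U n \ V n = (V n \ ∅ ∪ univ \ U n)ᶜ := by
      ext x; simp [and_comm]
    rw [hd]
    refine compl_mem_sigmaO one_le_two h (mem_sigmaO_two.2
      ⟨fun k => if k = 0 then V n else univ, fun k => if k = 0 then ∅ else U n, fun k => ?_,
        fun k => ?_, ?_⟩)
    · dsimp only; split_ifs
      exacts [hV n, isOpen_univ]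
    · dsimp only; split_ifs
      exacts [isOpen_empty, hU n]
    · ext x
      simp only [mem_union, mem_iUnion]
      constructor
      · rintro (hx | hx)
        exacts [⟨0, by simpa using hx⟩, ⟨1, by simpa using hx⟩]
      · rintro ⟨k, hx⟩
        by_cases hk : k = 0
        · exact .inl (by simpa [hk] using hx)
        · exact .inr (by simpa [hk] using hx)
  · obtain ⟨S, hS, rfl⟩ := (mem_sigmaO_of_two_lt h2).1 hA
    exact (mem_sigmaO_of_two_lt (h2.trans h)).2
      ⟨S, fun n => let ⟨γ, hγ, h⟩ := hS n; ⟨γ, hγ.trans ‹_›, h⟩, rfl⟩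

theorem union_mem_sigmaO {α : Ordinal.{0}} (h : 1 ≤ α) {A B : Set X} (hA : A ∈ SigmaO X α)
    (hB : B ∈ SigmaO X α) : A ∪ B ∈ SigmaO X α := by
  have hu : A ∪ B = ⋃ n : ℕ, if n = 0 then A else B := by
    ext x
    simp only [mem_union, mem_iUnion]
    constructor
    · rintro (hx | hx)
      exacts [⟨0, by simpa using hx⟩, ⟨1, by simpa using hx⟩]
    · rintro ⟨k, hx⟩
      split_ifs at hx
      exacts [.inl hx, .inr hx]
  rw [hu]
  refine iUnion_mem_sigmaO h fun n => ?_
  split_ifs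
  exacts [hA, hB]

theorem inter_mem_sigmaO {α : Ordinal.{0}} (h : 1 ≤ α) {A B : Set X} (hA : A ∈ SigmaO X α)
    (hB : B ∈ SigmaO X α) : A ∩ B ∈ SigmaO X α := by
  rcases eq_one_or_eq_two_or_two_lt h with rfl | rfl | h2
  · exact mem_sigmaO_one.2 ((mem_sigmaO_one.1 hA).inter (mem_sigmaO_one.1 hB))
  · obtain ⟨U, V, hU, hV, rfl⟩ := mem_sigmaO_two.1 hA
    obtain ⟨U', V', hU', hV', rfl⟩ := mem_sigmaO_two.1 hB
    rw [iUnion_inter_iUnion]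
    refine iUnion_mem_sigmaO h fun n => iUnion_mem_sigmaO h fun m => ?_
    have hd : (U n \ V n) ∩ (U' m \ V' m) = (U n ∩ U' m) \ (V n ∪ V' m) := by
      ext x; simp only [mem_inter_iff, mem_sdiff, mem_union]; tauto
    rw [hd]
    exact diff_mem_sigmaO_two ((hU n).inter (hU' m)) ((hV n).union (hV' m))
  · obtain ⟨S, hS, rfl⟩ := (mem_sigmaO_of_two_lt h2).1 hA
    obtain ⟨S', hS', rfl⟩ := (mem_sigmaO_of_two_lt h2).1 hB
    rw [iUnion_inter_iUnion]
    refine iUnion_mem_sigmaO h fun n => iUnion_mem_sigmaO h fun m => ?_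
    obtain ⟨β, hβ, hβ1, hn⟩ := hS n
    obtain ⟨γ, hγ, hγ1, hm⟩ := hS' m
    rw [← compl_union]
    exact compl_mem_sigmaO (hβ1.trans (le_max_left β γ)) (max_lt hβ hγ)
      (union_mem_sigmaO (hβ1.trans (le_max_left β γ)) (sigmaO_mono hβ1 (le_max_left β γ) hn)
        (sigmaO_mono hγ1 (le_max_right β γ) hm))

theorem preimage_mem_sigmaO {g : X → Y} (hg : Continuous g) (α : Ordinal.{0}) :
    ∀ A ∈ SigmaO Y α, g ⁻¹' A ∈ SigmaO X α := by
  induction α using WellFoundedLT.induction with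
  | ind α ih =>
    intro A hA
    rw [SigmaO] at hA ⊢
    split_ifs at hA ⊢ with h1 h2
    · exact IsOpen.preimage hg hA
    · obtain ⟨U, V, hU, hV, rfl⟩ := hA
      exact ⟨fun n => g ⁻¹' U n, fun n => g ⁻¹' V n, fun n => (hU n).preimage hg,
        fun n => (hV n).preimage hg, by simp⟩
    · obtain ⟨S, hS, rfl⟩ := hA
      refine ⟨fun n => g ⁻¹' S n, fun n => ?_, by simp⟩
      obtain ⟨β, hβ, hβ1, hn⟩ := hS n
      exact ⟨β, hβ, hβ1, ih β hβ _ hn⟩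

end SigmaO

/-! ### Reduction property -/

/-- A collection of sets closed under countable unions and finite intersections, all of whose
members are countable unions of sets that belong to it together with their complements, has the
σ-reduction property. -/
theorem sigmaReduction_of_ambiguous {X : Type} {𝒜 : Set (Set X)}
    (hU : ∀ A : ℕ → Set X, (∀ n, A n ∈ 𝒜) → (⋃ n, A n) ∈ 𝒜)
    (hI : ∀ A ∈ 𝒜, ∀ B ∈ 𝒜, A ∩ B ∈ 𝒜)
    (hK : ∀ A ∈ 𝒜, ∃ K : ℕ → Set X, (∀ n, K n ∈ 𝒜 ∧ (K n)ᶜ ∈ 𝒜) ∧ A = ⋃ n, K n) :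
    SigmaReduction 𝒜 := by
  intro C hC
  choose K hK hCK using fun i => hK (C i) (hC i)
  let P : ℕ → Set X := fun m => K m.unpair.1 m.unpair.2
  have hD : ∀ m, disjointed P m ∈ 𝒜 := fun m =>
    disjointedRec (p := (· ∈ 𝒜)) (fun {t i} ht => by
      rw [sdiff_eq]; exact hI _ ht _ (hK _ _).2) (hK _ _).1
  refine ⟨fun i => ⋃ j, disjointed P (Nat.pair i j), fun i => hU _ fun j => hD _, fun i => ?_,
    fun i j hij => ?_, ?_⟩
  · rw [hCK i]
    refine iUnion_mono fun j => ?_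
    simpa [P] using disjointed_subset P (Nat.pair i j)
  · rw [← disjoint_iff_inter_eq_empty]
    refine disjoint_iUnion_left.2 fun a => disjoint_iUnion_right.2 fun b =>
      disjoint_disjointed P fun h => hij ?_
    exact (Nat.pair_eq_pair.1 h).1
  · rw [← iUnion_unpair (fun i j => disjointed P (Nat.pair i j))]
    simp only [Nat.pair_unpair, iUnion_disjointed, P]
    rw [iUnion_unpair K]
    exact iUnion_congr fun i => (hCK i).symm

theorem exists_isClopen_iUnion_eq {C : Set (ℕ → ℕ)} (hC : IsOpen C) :
    ∃ K : ℕ → Set (ℕ → ℕ), (∀ n, IsClopen (K n)) ∧ C = ⋃ n, K n := by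
  have key : ∀ n x y, y ∈ PiNat.cylinder (E := fun _ => ℕ) x n →
      (PiNat.cylinder (E := fun _ => ℕ) y n ⊆ C ↔ PiNat.cylinder (E := fun _ => ℕ) x n ⊆ C) :=
    fun n x y h => by rw [PiNat.mem_cylinder_iff_eq.1 h]
  refine ⟨fun n => {x | PiNat.cylinder (E := fun _ => ℕ) x n ⊆ C}, fun n => ⟨⟨?_⟩, ?_⟩, ?_⟩
  · refine isOpen_iff_forall_mem_open.2 fun x hx =>
      ⟨_, fun y hy hy' => hx ((key n x y hy).1 hy'), PiNat.isOpen_cylinder _ x n,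
        PiNat.self_mem_cylinder x n⟩
  · refine isOpen_iff_forall_mem_open.2 fun x hx =>
      ⟨_, fun y hy => (key n x y hy).2 hx, PiNat.isOpen_cylinder _ x n,
        PiNat.self_mem_cylinder x n⟩
  · ext x
    simp only [mem_iUnion, mem_ofPred_eq]
    refine ⟨fun hx => ?_, fun ⟨n, hn⟩ => hn (PiNat.self_mem_cylinder x n)⟩
    obtain ⟨_, ⟨y, n, rfl⟩, hxy, hy⟩ :=
      (PiNat.isTopologicalBasis_cylinders fun _ => ℕ).exists_subset_of_mem_open hx hC
    exact ⟨n, by rwa [PiNat.mem_cylinder_iff_eq.1 hxy]⟩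

theorem sigmaReduction_sigmaO {α : Ordinal.{0}} (h : 1 ≤ α) :
    SigmaReduction (SigmaO (ℕ → ℕ) α) := by
  refine sigmaReduction_of_ambiguous (fun A hA => iUnion_mem_sigmaO h hA)
    (fun A hA B hB => inter_mem_sigmaO h hA hB) fun A hA => ?_
  rcases eq_one_or_eq_two_or_two_lt h with rfl | rfl | h2
  · obtain ⟨K, hK, rfl⟩ := exists_isClopen_iUnion_eq (mem_sigmaO_one.1 hA)
    exact ⟨K, fun n => ⟨mem_sigmaO_one.2 (hK n).2, mem_sigmaO_one.2 (hK n).1.1⟩, rfl⟩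
  · obtain ⟨U, V, hU, hV, rfl⟩ := mem_sigmaO_two.1 hA
    refine ⟨_, fun n => ⟨diff_mem_sigmaO_two (hU n) (hV n), ?_⟩, rfl⟩
    rw [sdiff_eq, compl_inter, compl_compl]
    exact union_mem_sigmaO h (compl_mem_sigmaO le_rfl one_lt_two (mem_sigmaO_one.2 (hU n)))
      (sigmaO_mono le_rfl one_le_two (mem_sigmaO_one.2 (hV n)))
  · obtain ⟨S, hS, rfl⟩ := (mem_sigmaO_of_two_lt h2).1 hA
    refine ⟨_, fun n => ?_, rfl⟩
    obtain ⟨β, hβ, hβ1, hn⟩ := hS n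
    rw [compl_compl]
    exact ⟨compl_mem_sigmaO hβ1 hβ hn, sigmaO_mono hβ1 hβ.le hn⟩

/-! ### Complete sets -/

/-- The `n`-th coordinate under the homeomorphism of the Baire space with its `ω`-th power. -/
def slice (n : ℕ) (x : ℕ → ℕ) : ℕ → ℕ := fun k => x (Nat.pair n k)

/-- The inverse of the homeomorphism whose coordinates are the maps `slice n`. -/
def glue (y : ℕ → ℕ → ℕ) : ℕ → ℕ := fun m => y m.unpair.1 m.unpair.2

@[simp]
theorem slice_glue (n : ℕ) (y : ℕ → ℕ → ℕ) : slice n (glue y) = y n := by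
  funext k; simp [slice, glue]

theorem continuous_slice (n : ℕ) : Continuous (slice n) :=
  continuous_pi fun _ => continuous_apply _

theorem Continuous.glue {X : Type} [TopologicalSpace X] {f : ℕ → X → ℕ → ℕ}
    (hf : ∀ n, Continuous (f n)) : Continuous fun x => glue fun n => f n x :=
  continuous_pi fun _ => (continuous_apply _).comp (hf _)

theorem lt_w1_iff {α : Ordinal.{0}} : α < w1 ↔ α.card ≤ Cardinal.aleph0 := by
  rw [w1, Cardinal.lt_ord, ← Cardinal.succ_aleph0, Order.lt_succ_iff]

theorem add_lt_w1 {α β : Ordinal.{0}} (hα : α < w1) (hβ : β < w1) : α + β < w1 := by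
  rw [lt_w1_iff] at *
  rw [Ordinal.card_add]
  exact Cardinal.add_le_aleph0.2 ⟨hα, hβ⟩

theorem one_lt_w1 : 1 < w1 := by simp [lt_w1_iff]

theorem omega0_opow_lt_w1 {α : Ordinal.{0}} (hα : α < w1) : Ordinal.omega0 ^ α < w1 := by
  rw [lt_w1_iff] at *
  refine (Ordinal.card_opow_le _ _).trans ?_
  simp [hα]

theorem countable_Iio_of_lt_w1 {α : Ordinal.{0}} (hα : α < w1) : (Iio α).Countable := by
  rw [← Cardinal.le_aleph0_iff_set_countable, Cardinal.mk_Iio_ordinal,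
    ← Cardinal.lift_aleph0.{1, 0}, Cardinal.lift_le]
  exact lt_w1_iff.1 hα

/-- Every countable non-zero level of the Borel hierarchy of the Baire space contains a
Wadge-complete set. -/
theorem exists_complete_sigmaO {α : Ordinal.{0}} (h : 1 ≤ α) (hα : α < w1) :
    ∃ W ∈ SigmaO (ℕ → ℕ) α, ∀ A ∈ SigmaO (ℕ → ℕ) α,
      ∃ f : (ℕ → ℕ) → ℕ → ℕ, Continuous f ∧ f ⁻¹' W = A := by
  classical
  induction α using WellFoundedLT.induction with
  | ind α ih =>
    rcases eq_one_or_eq_two_or_two_lt h with rfl | rfl | h2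
    · refine ⟨⋃ n, (fun x => x n) ⁻¹' {1}, ?_, fun A hA => ?_⟩
      · rw [mem_sigmaO_one]
        exact isOpen_iUnion fun n =>
          (isOpen_discrete ({1} : Set ℕ)).preimage (continuous_apply n)
      · obtain ⟨K, hK, rfl⟩ := exists_isClopen_iUnion_eq (mem_sigmaO_one.1 hA)
        refine ⟨fun x n => (K n).indicator 1 x, continuous_pi fun n =>
          continuous_one.indicator (by simp [(hK n).frontier_eq]), ?_⟩
        ext x
        simp [indicator_apply]
    · obtain ⟨W, hW, hc⟩ := ih 1 one_lt_two le_rfl one_lt_w1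
      refine ⟨⋃ n, slice (Nat.pair 0 n) ⁻¹' W \ slice (Nat.pair 1 n) ⁻¹' W, ?_, fun A hA => ?_⟩
      · exact mem_sigmaO_two.2 ⟨_, _,
          fun n => (mem_sigmaO_one.1 hW).preimage (continuous_slice _),
          fun n => (mem_sigmaO_one.1 hW).preimage (continuous_slice _), rfl⟩
      · obtain ⟨U, V, hU, hV, rfl⟩ := mem_sigmaO_two.1 hA
        choose f hf hfU using fun n => hc (U n) (mem_sigmaO_one.2 (hU n))
        choose g hg hgV using fun n => hc (V n) (mem_sigmaO_one.2 (hV n))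
        refine ⟨fun x => glue fun m => if m.unpair.1 = 0 then f m.unpair.2 x else g m.unpair.2 x,
          Continuous.glue fun m => ?_, ?_⟩
        · split_ifs
          exacts [hf _, hg _]
        · ext x
          simp [← hfU, ← hgV]
    · have : Nonempty {β // β < α ∧ 1 ≤ β} := ⟨⟨1, one_lt_two.trans h2, le_rfl⟩⟩
      have : Countable {β // β < α ∧ 1 ≤ β} :=
        ((countable_Iio_of_lt_w1 hα).mono fun β (hβ : β < α ∧ 1 ≤ β) => hβ.1).to_subtype
      obtain ⟨e, he⟩ := exists_surjective_nat {β // β < α ∧ 1 ≤ β}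
      choose W hW hc using fun k => ih (e k).1 (e k).2.1 (e k).2.2 ((e k).2.1.trans hα)
      refine ⟨⋃ m : ℕ, (slice m ⁻¹' W m.unpair.1)ᶜ, ?_, fun A hA => ?_⟩
      · exact (mem_sigmaO_of_two_lt h2).2 ⟨_, fun m => ⟨_, (e m.unpair.1).2.1, (e m.unpair.1).2.2,
          preimage_mem_sigmaO (continuous_slice m) _ _ (hW _)⟩, rfl⟩
      · obtain ⟨S, hS, rfl⟩ := (mem_sigmaO_of_two_lt h2).1 hA
        let T : ℕ → Set (ℕ → ℕ) := fun m =>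
          if S m.unpair.2 ∈ SigmaO (ℕ → ℕ) (e m.unpair.1).1 then S m.unpair.2 else univ
        have hT : ∀ m, T m ∈ SigmaO (ℕ → ℕ) (e m.unpair.1).1 := fun m => by
          dsimp only [T]
          split_ifs with hm
          exacts [hm, univ_mem_sigmaO (e m.unpair.1).2.2]
        choose f hf hfT using fun m => hc m.unpair.1 (T m) (hT m)
        refine ⟨fun x => glue fun m => f m x, Continuous.glue hf, ?_⟩
        have hfT' : ∀ m x, f m x ∈ W m.unpair.1 ↔ x ∈ T m := fun m x => by
          rw [← hfT m, mem_preimage]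
        ext x
        simp only [mem_preimage, mem_iUnion, mem_compl_iff, slice_glue, hfT']
        constructor
        · rintro ⟨m, hm⟩
          dsimp only [T] at hm
          split_ifs at hm
          exacts [⟨_, hm⟩, absurd (mem_univ x) hm]
        · rintro ⟨n, hn⟩
          obtain ⟨β, hβ, hβ1, hSn⟩ := hS n
          obtain ⟨k, hk⟩ := he ⟨β, hβ, hβ1⟩
          exact ⟨Nat.pair k n, by simpa [T, hk, hSn] using hn⟩

/-- There is a sequence of pairwise disjoint sets of a given Borel level such that every sequence
of sets of that level is reduced by a continuous preimage of it. -/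
theorem exists_complete_reduced_seq {α : Ordinal.{0}} (h : 1 ≤ α) (hα : α < w1) :
    ∃ V : ℕ → Set (ℕ → ℕ), (∀ i, V i ∈ SigmaO (ℕ → ℕ) α) ∧
      (∀ i j, i ≠ j → V i ∩ V j = ∅) ∧
      ∀ C : ℕ → Set (ℕ → ℕ), (∀ i, C i ∈ SigmaO (ℕ → ℕ) α) →
        ∃ f : (ℕ → ℕ) → ℕ → ℕ, Continuous f ∧ (∀ i, f ⁻¹' V i ⊆ C i) ∧
          f ⁻¹' (⋃ i, V i) = ⋃ i, C i := by
  obtain ⟨W, hW, hc⟩ := exists_complete_sigmaO h hα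
  obtain ⟨V, hV, hVW, hdisj, hU⟩ := sigmaReduction_sigmaO h (fun i => slice i ⁻¹' W)
    fun i => preimage_mem_sigmaO (continuous_slice i) _ _ hW
  refine ⟨V, hV, hdisj, fun C hC => ?_⟩
  choose f hf hfC using fun i => hc (C i) (hC i)
  have hslice : ∀ i, (fun x => glue fun n => f n x) ⁻¹' (slice i ⁻¹' W) = C i := fun i => by
    rw [← hfC i]; ext x; simp
  refine ⟨_, Continuous.glue hf, fun i => ?_, ?_⟩
  · rw [← hslice i]
    exact preimage_mono (hVW i)
  · rw [hU, preimage_iUnion]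
    exact iUnion_congr hslice

/-! ### Levels of the fine hierarchy -/

section Level

variable {X Q : Type} {L : Ordinal.{0} → Set (Set X)} {D : Set X} {A : X → Q}

theorem mem_levelOn_const {q : Q} : A ∈ levelOn Q L D (.const q) ↔ ∀ x ∈ D, A x = q := by
  constructor
  · rintro ⟨F, hF⟩
    cases F
    exact hF
  · exact fun h => ⟨.const q L D, h⟩

theorem mem_levelOn_s {a : CtbOrd} {u : Term Q} :
    A ∈ levelOn Q L D (.s a u) ↔ A ∈ levelOn Q (shiftL L (Ordinal.omega0 ^ a.1)) D u := by
  constructor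
  · rintro ⟨F, hF⟩
    cases F with
    | s _ _ _ _ F => exact ⟨F, hF⟩
  · exact fun ⟨F, hF⟩ => ⟨.s a u L D F, hF⟩

theorem mem_levelOn_Fc {q : Q} {us : ℕ → Term Q} :
    A ∈ levelOn Q L D (.Fc q us) ↔ ∃ U : ℕ → Set X, (∀ i, U i ∈ restrictL L D 0) ∧
      (∀ x ∈ D \ ⋃ i, U i, A x = q) ∧ ∀ i, A ∈ levelOn Q L (U i) (us i) := by
  constructor
  · rintro ⟨F, hF⟩
    cases F with
    | Fc _ _ _ _ U hU fams => exact ⟨U, hU, hF.1, fun i => ⟨fams i, hF.2 i⟩⟩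
  · rintro ⟨U, hU, hq, h⟩
    choose fams hfams using h
    exact ⟨.Fc q us L D U hU fams, hq, hfams⟩

theorem mem_levelOn_Fo {a : CtbOrd} {us : ℕ → Term Q} :
    A ∈ levelOn Q L D (.Fo a us) ↔ ∃ U : ℕ → Set X, (∀ i, U i ∈ restrictL L D 0) ∧
      A ∈ levelOn Q (shiftL L (Ordinal.omega0 ^ a.1)) (D \ ⋃ i, U i) (us 0) ∧
      ∀ i, A ∈ levelOn Q L (U i) (us (i + 1)) := by
  constructor
  · rintro ⟨F, hF⟩
    cases F with
    | Fo _ _ _ _ U hU F0 fams => exact ⟨U, hU, ⟨F0, hF.1⟩, fun i => ⟨fams i, hF.2 i⟩⟩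
  · rintro ⟨U, hU, ⟨F0, hF0⟩, h⟩
    choose fams hfams using h
    exact ⟨.Fo a us L D U hU F0 fams, hF0, hfams⟩

/-- The levels are closed under preimages by maps that respect the bases. -/
theorem mem_levelOn_of_eqOn_comp {Y : Type} {M : Ordinal.{0} → Set (Set Y)} {B : Y → Q}
    {E : Set Y} {u : Term Q} {g : X → Y} (hg : ∀ α, ∀ S ∈ M α, g ⁻¹' S ∈ L α)
    (hD : MapsTo g D E) (hA : EqOn A (B ∘ g) D) (hB : B ∈ levelOn Q M E u) :
    A ∈ levelOn Q L D u := by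
  induction u generalizing L M D E with
  | const q =>
    rw [mem_levelOn_const] at *
    exact fun x hx => (hA hx).trans (hB _ (hD hx))
  | s a u ih =>
    rw [mem_levelOn_s] at *
    exact ih (fun α => hg _) hD hA hB
  | Fc q us ih =>
    rw [mem_levelOn_Fc] at *
    obtain ⟨U, hU, hq, h⟩ := hB
    choose S hS hUS using hU
    have hmaps : ∀ i, MapsTo g (D ∩ g ⁻¹' S i) (U i) := fun i x hx =>
      (hUS i).symm ▸ ⟨hD hx.1, hx.2⟩
    refine ⟨fun i => D ∩ g ⁻¹' S i, fun i => ⟨_, hg _ _ (hS i), rfl⟩, fun x hx => ?_, fun i =>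
      ih i hg (hmaps i) (hA.mono inter_subset_left) (h i)⟩
    refine (hA hx.1).trans (hq _ ⟨hD hx.1, fun hU => hx.2 ?_⟩)
    obtain ⟨i, hi⟩ := mem_iUnion.1 hU
    rw [hUS i] at hi
    exact mem_iUnion.2 ⟨i, hx.1, hi.2⟩
  | Fo a us ih =>
    rw [mem_levelOn_Fo] at *
    obtain ⟨U, hU, h0, h⟩ := hB
    choose S hS hUS using hU
    have hmaps : ∀ i, MapsTo g (D ∩ g ⁻¹' S i) (U i) := fun i x hx =>
      (hUS i).symm ▸ ⟨hD hx.1, hx.2⟩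
    have hmaps0 : MapsTo g (D \ ⋃ i, D ∩ g ⁻¹' S i) (E \ ⋃ i, U i) := fun x hx => by
      refine ⟨hD hx.1, fun hU => hx.2 ?_⟩
      obtain ⟨i, hi⟩ := mem_iUnion.1 hU
      rw [hUS i] at hi
      exact mem_iUnion.2 ⟨i, hx.1, hi.2⟩
    exact ⟨fun i => D ∩ g ⁻¹' S i, fun i => ⟨_, hg _ _ (hS i), rfl⟩,
      ih 0 (fun α => hg _) hmaps0 (hA.mono sdiff_subset) h0,
      fun i => ih (i + 1) hg (hmaps i) (hA.mono inter_subset_left) (h i)⟩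

theorem shiftL_zero : shiftL L 0 = L := by
  funext α; simp [shiftL]

theorem shiftL_shiftL (β γ : Ordinal.{0}) : shiftL (shiftL L β) γ = shiftL L (β + γ) := by
  funext α; simp [shiftL, add_assoc]

end Level

theorem preimage_mem_shiftL_borelBase {X Y : Type} [TopologicalSpace X] [TopologicalSpace Y]
    {g : X → Y} (hg : Continuous g) (β α : Ordinal.{0}) :
    ∀ S ∈ shiftL (borelBase Y) β α, g ⁻¹' S ∈ shiftL (borelBase X) β α :=
  preimage_mem_sigmaO hg _

open Classical in
/-- The function that decodes `x` as a sequence: if the coordinate `0` lies in one of the disjoint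
sets `V i`, it applies `B i` to the coordinate `i + 2`, otherwise it applies `B₀` to the
coordinate `1`. -/
def amalgam {Q : Type} (V : ℕ → Set (ℕ → ℕ)) (B₀ : (ℕ → ℕ) → Q) (B : ℕ → (ℕ → ℕ) → Q)
    (x : ℕ → ℕ) : Q :=
  if h : ∃ i, slice 0 x ∈ V i then B h.choose (slice (h.choose + 2) x) else B₀ (slice 1 x)

section Amalgam

variable {Q : Type} {V : ℕ → Set (ℕ → ℕ)} {B₀ : (ℕ → ℕ) → Q} {B : ℕ → (ℕ → ℕ) → Q}

theorem amalgam_of_mem (hV : ∀ i j, i ≠ j → V i ∩ V j = ∅) {i : ℕ} {x : ℕ → ℕ}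
    (hx : slice 0 x ∈ V i) : amalgam V B₀ B x = B i (slice (i + 2) x) := by
  have h : ∃ i, slice 0 x ∈ V i := ⟨i, hx⟩
  have hi : h.choose = i := by
    by_contra hne
    exact (hV _ _ hne).subset ⟨h.choose_spec, hx⟩
  rw [amalgam, dif_pos h, hi]

theorem amalgam_of_notMem {x : ℕ → ℕ} (hx : slice 0 x ∉ ⋃ i, V i) :
    amalgam V B₀ B x = B₀ (slice 1 x) :=
  dif_neg fun h => hx (mem_iUnion.2 h)

/-- The combinatorial core shared by the two infinitary term constructors: functions that reduce
the parts of `A` to `B₀` and the `B i` combine to a reduction of `A` to the amalgam. -/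
theorem exists_reduction_to_amalgam {α : Ordinal.{0}} (hV : ∀ i j, i ≠ j → V i ∩ V j = ∅)
    (hc : ∀ C : ℕ → Set (ℕ → ℕ), (∀ i, C i ∈ SigmaO (ℕ → ℕ) α) →
      ∃ f : (ℕ → ℕ) → ℕ → ℕ, Continuous f ∧ (∀ i, f ⁻¹' V i ⊆ C i) ∧
        f ⁻¹' (⋃ i, V i) = ⋃ i, C i)
    {D : Set (ℕ → ℕ)} {U : ℕ → Set (ℕ → ℕ)} {A : (ℕ → ℕ) → Q}
    (hU : ∀ i, ∃ S ∈ SigmaO (ℕ → ℕ) α, U i = D ∩ S)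
    (h₀ : ∃ g : (ℕ → ℕ) → ℕ → ℕ, Continuous g ∧ EqOn A (B₀ ∘ g) (D \ ⋃ i, U i))
    (h : ∀ i, ∃ g : (ℕ → ℕ) → ℕ → ℕ, Continuous g ∧ EqOn A (B i ∘ g) (U i)) :
    ∃ f : (ℕ → ℕ) → ℕ → ℕ, Continuous f ∧ EqOn A (amalgam V B₀ B ∘ f) D := by
  choose S hS hUS using hU
  obtain ⟨g₀, hg₀, hA₀⟩ := h₀
  choose g hg hA using h
  obtain ⟨f, hf, hfS, hfU⟩ := hc S hS
  let F : ℕ → (ℕ → ℕ) → ℕ → ℕ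
    | 0 => f
    | 1 => g₀
    | i + 2 => g i
  have hF : ∀ n, Continuous (F n)
    | 0 => hf
    | 1 => hg₀
    | i + 2 => hg i
  refine ⟨_, Continuous.glue hF, fun x hx => ?_⟩
  by_cases hxV : f x ∈ ⋃ i, V i
  · obtain ⟨i, hi⟩ := mem_iUnion.1 hxV
    have hxU : x ∈ U i := by
      rw [hUS i]; exact ⟨hx, hfS i hi⟩
    rw [Function.comp_apply, amalgam_of_mem hV (i := i) (by rwa [slice_glue]), slice_glue]
    exact hA i hxU
  · rw [Function.comp_apply, amalgam_of_notMem (by rwa [slice_glue]), slice_glue]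
    refine hA₀ ⟨hx, fun hxU => hxV ?_⟩
    obtain ⟨i, hi⟩ := mem_iUnion.1 hxU
    rw [hUS i] at hi
    rw [← mem_preimage, hfU]
    exact mem_iUnion.2 ⟨i, hi.2⟩

end Amalgam

/-- Every level over a countable shift of the Borel base of the Baire space contains an element
to which all elements of the level, on arbitrary domains, are continuously reducible. -/
theorem exists_complete_levelOn {Q : Type} (u : Term Q) {β : Ordinal.{0}} (hβ : β < w1) :
    ∃ B ∈ level Q (shiftL (borelBase (ℕ → ℕ)) β) u,
      ∀ D, ∀ A ∈ levelOn Q (shiftL (borelBase (ℕ → ℕ)) β) D u,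
        ∃ f : (ℕ → ℕ) → ℕ → ℕ, Continuous f ∧ EqOn A (B ∘ f) D := by
  induction u generalizing β with
  | const q =>
    refine ⟨fun _ => q, mem_levelOn_const.2 fun _ _ => rfl, fun D A hA => ⟨id, continuous_id, ?_⟩⟩
    exact mem_levelOn_const.1 hA
  | s a u ih =>
    obtain ⟨B, hB, hc⟩ := ih (add_lt_w1 hβ (omega0_opow_lt_w1 a.2))
    rw [← shiftL_shiftL] at hB hc
    exact ⟨B, mem_levelOn_s.2 hB, fun D A hA => hc D A (mem_levelOn_s.1 hA)⟩
  | Fc q us ih =>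
    choose B hB hc using fun i => ih i hβ
    obtain ⟨V, hV, hdisj, hVc⟩ := exists_complete_reduced_seq (α := 1 + (β + 0)) le_self_add
      (add_lt_w1 one_lt_w1 (by rwa [add_zero]))
    refine ⟨amalgam V (fun _ => q) B, mem_levelOn_Fc.2 ⟨fun i => slice 0 ⁻¹' V i, fun i =>
      ⟨_, preimage_mem_sigmaO (continuous_slice 0) _ _ (hV i), (univ_inter _).symm⟩,
      fun x hx => amalgam_of_notMem fun h => hx.2 (by rwa [← preimage_iUnion]), fun i =>
        mem_levelOn_of_eqOn_comp (preimage_mem_shiftL_borelBase (continuous_slice (i + 2)) β)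
          (mapsTo_univ _ _) (fun x hx => amalgam_of_mem hdisj hx) (hB i)⟩, fun D A hA => ?_⟩
    obtain ⟨U, hU, hq, h⟩ := mem_levelOn_Fc.1 hA
    exact exists_reduction_to_amalgam hdisj hVc hU ⟨id, continuous_id, hq⟩
      fun i => hc i _ _ (h i)
  | Fo a us ih =>
    choose B hB hc using fun i => ih (i + 1) hβ
    obtain ⟨B₀, hB₀, hc₀⟩ := ih 0 (add_lt_w1 hβ (omega0_opow_lt_w1 a.2))
    obtain ⟨V, hV, hdisj, hVc⟩ := exists_complete_reduced_seq (α := 1 + (β + 0)) le_self_add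
      (add_lt_w1 one_lt_w1 (by rwa [add_zero]))
    refine ⟨amalgam V B₀ B, mem_levelOn_Fo.2 ⟨fun i => slice 0 ⁻¹' V i, fun i =>
      ⟨_, preimage_mem_sigmaO (continuous_slice 0) _ _ (hV i), (univ_inter _).symm⟩, ?_, fun i =>
        mem_levelOn_of_eqOn_comp (preimage_mem_shiftL_borelBase (continuous_slice (i + 2)) β)
          (mapsTo_univ _ _) (fun x hx => amalgam_of_mem hdisj hx) (hB i)⟩, fun D A hA => ?_⟩
    · rw [shiftL_shiftL]
      exact mem_levelOn_of_eqOn_comp (preimage_mem_shiftL_borelBase (continuous_slice 1) _)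
        (mapsTo_univ _ _)
        (fun x hx => amalgam_of_notMem fun h => hx.2 (by rwa [← preimage_iUnion])) hB₀
    · obtain ⟨U, hU, h₀, h⟩ := mem_levelOn_Fo.1 hA
      rw [shiftL_shiftL] at h₀
      exact exists_reduction_to_amalgam hdisj hVc hU (hc₀ _ _ h₀) fun i => hc i _ _ (h i)

/-- Corollary "wcomp": every level of the `Q`-IFH in the Baire space has a Wadge-complete
`Q`-partition. -/
theorem statement19 {Q : Type} [Preorder Q] (u : Term Q) :
    ∃ B ∈ level Q (borelBase (ℕ → ℕ)) u,
      ∀ A ∈ level Q (borelBase (ℕ → ℕ)) u, WadgeLe A B := by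
  obtain ⟨B, hB, hc⟩ := exists_complete_levelOn (Q := Q) u (zero_lt_one.trans one_lt_w1)
  rw [shiftL_zero] at hB hc
  refine ⟨B, hB, fun A hA => ?_⟩
  obtain ⟨f, hf, hAf⟩ := hc univ A hA
  exact ⟨f, hf, fun x => (hAf (mem_univ x)).le⟩

end

end IFHpaper
end
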